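/- Assume p is q²-separable, q is not a root of unity, and α₀, α₋, α₊ are nonzero. Then: (i) every homogeneous element of A(p;q) of nonzero ℤ-degree lies in Im(div); (ii) for all k, l ∈ ℕ, the elements (x₋z₊)^{k+1}(z₋z₊)^l and (z₋x₊)^{k+1}(z₋z₊)^l lie in Im(div); (iii) for every polynomial f ∈ K[z], the element q²p(q²z)f(q²z) − p(z)f(z), evaluated at z = z₋z₊, lies in Im(div). Consequently, the integral Λ: A(p;q) → coker(div) vanishes on all homogeneous elements of nonzero degree and on all (x₋z₊)^{k+1}(z₋z₊)^l and (z₋x₊)^{k+1}(z₋z₊)^l, and satisfies Λ(q²p(q²z)f(q²z)) = Λ(p(z)f(z)) for all f ∈ K[z]. -/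

import Mathlib

noncomputable section

open Polynomial
open scoped Classical

namespace GWAPaper

variable (K : Type) [Field K]

/-- Defining relations of the generalized Weyl algebra `A(p;q)`; the generators are
indexed by `Fin 4` with `0 ↦ x₊`, `1 ↦ x₋`, `2 ↦ z₊`, `3 ↦ z₋`. -/
inductive GWARel (q : K) (p : K[X]) :
    FreeAlgebra K (Fin 4) → FreeAlgebra K (Fin 4) → Prop
  | zz : GWARel q p (FreeAlgebra.ι K (2 : Fin 4) * FreeAlgebra.ι K (3 : Fin 4))
      (FreeAlgebra.ι K (3 : Fin 4) * FreeAlgebra.ι K (2 : Fin 4))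
  | xpzp : GWARel q p (FreeAlgebra.ι K (0 : Fin 4) * FreeAlgebra.ι K (2 : Fin 4))
      (q⁻¹ • (FreeAlgebra.ι K (2 : Fin 4) * FreeAlgebra.ι K (0 : Fin 4)))
  | xpzm : GWARel q p (FreeAlgebra.ι K (0 : Fin 4) * FreeAlgebra.ι K (3 : Fin 4))
      (q⁻¹ • (FreeAlgebra.ι K (3 : Fin 4) * FreeAlgebra.ι K (0 : Fin 4)))
  | xmzp : GWARel q p (FreeAlgebra.ι K (1 : Fin 4) * FreeAlgebra.ι K (2 : Fin 4))
      (q • (FreeAlgebra.ι K (2 : Fin 4) * FreeAlgebra.ι K (1 : Fin 4)))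
  | xmzm : GWARel q p (FreeAlgebra.ι K (1 : Fin 4) * FreeAlgebra.ι K (3 : Fin 4))
      (q • (FreeAlgebra.ι K (3 : Fin 4) * FreeAlgebra.ι K (1 : Fin 4)))
  | xpxm : GWARel q p (FreeAlgebra.ι K (0 : Fin 4) * FreeAlgebra.ι K (1 : Fin 4))
      (Polynomial.aeval (FreeAlgebra.ι K (2 : Fin 4) * FreeAlgebra.ι K (3 : Fin 4)) p)
  | xmxp : GWARel q p (FreeAlgebra.ι K (1 : Fin 4) * FreeAlgebra.ι K (0 : Fin 4))
      (Polynomial.aeval ((q ^ 2 : K) • (FreeAlgebra.ι K (3 : Fin 4) * FreeAlgebra.ι K (2 : Fin 4))) p)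

/-- The generalized Weyl algebra `A(p;q)`. -/
abbrev GWA (q : K) (p : K[X]) : Type := RingQuot (GWARel K q p)

/-- The images of the four generators in `A(p;q)`. -/
def gwaGen (q : K) (p : K[X]) (i : Fin 4) : GWA K q p :=
  RingQuot.mkAlgHom K (GWARel K q p) (FreeAlgebra.ι K i)

/-- The generator `x₊`. -/
def xp (q : K) (p : K[X]) : GWA K q p := gwaGen K q p 0
/-- The generator `x₋`. -/
def xm (q : K) (p : K[X]) : GWA K q p := gwaGen K q p 1
/-- The generator `z₊`. -/
def zp (q : K) (p : K[X]) : GWA K q p := gwaGen K q p 2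
/-- The generator `z₋`. -/
def zm (q : K) (p : K[X]) : GWA K q p := gwaGen K q p 3

/-- ℤ-degrees of the generators: `deg x₊ = deg z₊ = 1`, `deg x₋ = deg z₋ = -1`. -/
def gwaWt : Fin 4 → ℤ := ![1, -1, 1, -1]

/-- The total degree of a word in the generators. -/
def wordDeg (w : List (Fin 4)) : ℤ := (w.map gwaWt).sum

/-- The product in `A(p;q)` of the letters of a word. -/
def wordVal (q : K) (p : K[X]) (w : List (Fin 4)) : GWA K q p :=
  (w.map (gwaGen K q p)).prod

/-- The degree-`n` homogeneous component of the ℤ-graded algebra `A(p;q)`: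
the `K`-linear span of the values of all words of total degree `n`. -/
def component (q : K) (p : K[X]) (n : ℤ) : Submodule K (GWA K q p) :=
  Submodule.span K {a | ∃ w : List (Fin 4), wordDeg w = n ∧ wordVal K q p w = a}

/-- The `q²`-derivative `p_{q²}` of a polynomial `p`, equal to
`(p(q²z) - p(z))/((q²-1)z)` if `q² ≠ 1` and to `p'` if `q² = 1`. -/
def qDeriv (q : K) (p : K[X]) : K[X] :=
  if q ^ 2 = 1 then derivative p
  else (p.comp (C (q ^ 2) * X) - p) / (C (q ^ 2 - 1) * X)

/-- The polynomial `c(z) = q·p_{q²}(z)`. -/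
def cPoly (q : K) (p : K[X]) : K[X] := C q * qDeriv K q p

/-- `p` is `q²`-separable: `p(z)` is coprime with `z·p_{q²}(z)`. -/
def QSeparable (q : K) (p : K[X]) : Prop := IsCoprime p (X * qDeriv K q p)

/-- The right `A(p;q)`-action on the free left module `Ω = A(p;q)³` with basis
`ω₋, ω₀, ω₊` (coordinates `0, 1, 2`), twisted by the automorphisms `σ₋ = σ₊` and `σ₀`:
`ω₋·a = σ₋(a)·ω₋`, `ω₀·a = σ₀(a)·ω₀`, `ω₊·a = σ₊(a)·ω₊`. -/
def rAct (q : K) (p : K[X]) (σm σ0 : GWA K q p ≃ₐ[K] GWA K q p)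
    (ω : Fin 3 → GWA K q p) (a : GWA K q p) : Fin 3 → GWA K q p :=
  ![ω 0 * σm a, ω 1 * σ0 a, ω 2 * σm a]

/-- A right `A(p;q)`-module map `Ω → A(p;q)`, where `Ω` is the free left module
with basis `ω₋, ω₀, ω₊` and right action `rAct`. -/
structure OmegaRightHom (q : K) (p : K[X]) (σm σ0 : GWA K q p ≃ₐ[K] GWA K q p) : Type where
  toFun : (Fin 3 → GWA K q p) → GWA K q p
  map_add' : ∀ ω η, toFun (ω + η) = toFun ω + toFun η
  map_rmul' : ∀ ω a, toFun (rAct K q p σm σ0 ω a) = toFun ω * a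

/-- The divergence associated with the calculus `(Ω, d)`:
`div(ξ) = q⁻²·∂₋(ξ(ω₋)) + ∂₀(ξ(ω₀)) + q²·∂₊(ξ(ω₊))`. -/
def divMap (q : K) (p : K[X]) (σm σ0 : GWA K q p ≃ₐ[K] GWA K q p)
    (D0 Dm Dp : GWA K q p →ₗ[K] GWA K q p) (ξ : OmegaRightHom K q p σm σ0) : GWA K q p :=
  q ^ (-2 : ℤ) • Dm (ξ.toFun ![1, 0, 0]) + D0 (ξ.toFun ![0, 1, 0]) + q ^ 2 • Dp (ξ.toFun ![0, 0, 1])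

/-- The image of the divergence, as a `K`-subspace of `A(p;q)`. -/
def imDiv (q : K) (p : K[X]) (σm σ0 : GWA K q p ≃ₐ[K] GWA K q p)
    (D0 Dm Dp : GWA K q p →ₗ[K] GWA K q p) : Submodule K (GWA K q p) :=
  Submodule.span K (Set.range (divMap K q p σm σ0 D0 Dm Dp))


section SkewCommutation

variable {F A : Type*} [Field F] [Ring A] [Algebra F A]

theorem mul_pow_of_skewCommute {r : F} {u v : A} (h : v * u = r • (u * v)) (n : ℕ) :
    v * u ^ n = r ^ n • (u ^ n * v) := by
  induction n with
  | zero => simp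
  | succ n ih =>
    rw [pow_succ, ← mul_assoc, ih, smul_mul_assoc, mul_assoc, h, mul_smul_comm, smul_smul,
      ← mul_assoc, ← pow_succ, ← pow_succ]

theorem pow_mul_of_skewCommute {r : F} {u v : A} (h : v * u = r • (u * v)) (n : ℕ) :
    v ^ n * u = r ^ n • (u * v ^ n) := by
  induction n with
  | zero => simp
  | succ n ih =>
    rw [pow_succ', mul_assoc, ih, mul_smul_comm, ← mul_assoc, h, smul_mul_assoc, smul_smul,
      mul_assoc, ← pow_succ', ← pow_succ]

theorem exists_mul_pow_eq_of_skewCommute {r : F} (hr : r ≠ 0) {u v : A}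
    (h : v * u = r • (u * v)) (n : ℕ) :
    ∃ c : F, (v * u) ^ n = c • (v ^ n * u ^ n) := by
  induction n with
  | zero => exact ⟨1, by simp⟩
  | succ n ih =>
    obtain ⟨c, hc⟩ := ih
    refine ⟨c * (r ^ n)⁻¹, ?_⟩
    have e : u * v ^ n = (r ^ n)⁻¹ • (v ^ n * u) := by
      rw [pow_mul_of_skewCommute h, smul_smul, inv_mul_cancel₀ (pow_ne_zero _ hr), one_smul]
    calc (v * u) ^ (n + 1) = c • (v * (u * v ^ n) * u ^ n) := by
          rw [pow_succ', hc, mul_smul_comm]; simp only [mul_assoc]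
      _ = _ := by
          rw [e, mul_smul_comm, smul_mul_assoc, smul_smul, pow_succ' v, pow_succ' u]
          simp only [mul_assoc]

/-- A map `D` satisfying the Leibniz rule twisted by `σ`. -/
structure IsSkewDerivation (σ : A ≃ₐ[F] A) (D : A →ₗ[F] A) : Prop where
  leibniz : ∀ a b, D (a * b) = D a * σ b + a * D b

namespace IsSkewDerivation

variable {σ : A ≃ₐ[F] A} {D : A →ₗ[F] A}

theorem map_one (hD : IsSkewDerivation σ D) : D 1 = 0 := by
  simpa using hD.leibniz 1 1

theorem map_pow_eq_zero (hD : IsSkewDerivation σ D) {a : A} (ha : D a = 0) (n : ℕ) :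
    D (a ^ n) = 0 := by
  induction n with
  | zero => simpa using hD.map_one
  | succ n ih => rw [pow_succ, hD.leibniz, ih, ha, zero_mul, mul_zero, add_zero]

theorem map_pow_succ (hD : IsSkewDerivation σ D) {r a : F} {u v : A}
    (h : v * u = r • (u * v)) (hσ : σ u = r • u) (hu : D u = a • v) (n : ℕ) :
    D (u ^ (n + 1)) = (a * ∑ i ∈ Finset.range (n + 1), (r ^ 2) ^ i) • (u ^ n * v) := by
  induction n with
  | zero => simp [hu]
  | succ n ih =>
    rw [pow_succ', hD.leibniz, ih, hu, map_pow, hσ, _root_.smul_pow, mul_smul_comm, mul_smul_comm,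
      smul_mul_assoc, mul_pow_of_skewCommute h, smul_smul, smul_smul, ← mul_assoc, ← pow_succ',
      ← add_smul, Finset.sum_range_succ _ (n + 1)]
    congr 1
    ring

/-- If `D` kills `v` and `t` and sends `u` to a nonzero multiple of `v`, then a submodule
containing the image of `D` contains `(v u)^(k+1) (t u)^l`. -/
theorem mul_pow_mul_pow_mem (hD : IsSkewDerivation σ D) {S : Submodule F A}
    (hS : ∀ a, D a ∈ S) {r a : F} (hr : r ≠ 0) (ha : a ≠ 0)
    (hgeom : ∀ n : ℕ, ∑ i ∈ Finset.range (n + 1), (r ^ 2) ^ i ≠ 0) {u v t : A}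
    (h : v * u = r • (u * v)) (htu : Commute t u) (hσ : σ u = r • u) (hσt : σ t = r⁻¹ • t)
    (hu : D u = a • v) (hv : D v = 0) (ht : D t = 0) (k l : ℕ) :
    (v * u) ^ (k + 1) * (t * u) ^ l ∈ S := by
  obtain ⟨c, hc⟩ := exists_mul_pow_eq_of_skewCommute hr h (k + 1)
  set n := k + 1 + l with hn
  have huv : u ^ n * v = (r ^ n)⁻¹ • (v * u ^ n) := by
    rw [mul_pow_of_skewCommute h, smul_smul, inv_mul_cancel₀ (pow_ne_zero _ hr), one_smul]
  have key : D (v ^ k * (u ^ (n + 1) * t ^ l)) =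
      ((a * ∑ i ∈ Finset.range (n + 1), (r ^ 2) ^ i) * (r⁻¹ ^ l * (r ^ n)⁻¹)) •
        (v ^ (k + 1) * u ^ (k + 1) * (t * u) ^ l) := by
    rw [hD.leibniz, hD.map_pow_eq_zero hv, zero_mul, zero_add, hD.leibniz,
      hD.map_pow_eq_zero ht, mul_zero, add_zero, hD.map_pow_succ h hσ hu, map_pow, hσt,
      _root_.smul_pow, huv, htu.mul_pow, (htu.pow_pow l l).eq, hn, pow_add u, pow_succ v]
    simp only [mul_smul_comm, smul_mul_assoc, smul_smul, mul_assoc]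
    congr 1
    ring
  rw [hc, smul_mul_assoc]
  refine S.smul_mem _ ?_
  have hne : (a * ∑ i ∈ Finset.range (n + 1), (r ^ 2) ^ i) * (r⁻¹ ^ l * (r ^ n)⁻¹) ≠ 0 :=
    mul_ne_zero (mul_ne_zero ha (hgeom n))
      (mul_ne_zero (pow_ne_zero _ (inv_ne_zero hr)) (inv_ne_zero (pow_ne_zero _ hr)))
  exact (S.smul_mem_iff hne).1 (key ▸ hS _)

/-- The value of a skew derivation on `x u^(l+1) t^l`, where `x` and `v` are the two
generators whose product is `P`. -/
theorem map_mul_pow_mul_pow (hD : IsSkewDerivation σ D) {q a : F} (hq : q ≠ 0)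
    {x u v t c P : A} (h : v * u = q • (u * v)) (hvt : v * t = q • (t * v))
    (hxu : x * u = q⁻¹ • (u * x)) (hxt : x * t = q⁻¹ • (t * x)) (hxv : x * v = P)
    (htu : Commute t u) (hσ : σ u = q • u) (hσt : σ t = q⁻¹ • t)
    (hx : D x = a • (c * t)) (hu : D u = a • v) (ht : D t = 0) (l : ℕ) :
    D (x * u ^ (l + 1) * t ^ l) = (a * (q⁻¹ ^ l) ^ 2) •
      ((q ^ (2 * l + 1)) • (c * (t * u) ^ (l + 1)) +
        (∑ i ∈ Finset.range (l + 1), (q ^ 2) ^ i) • ((t * u) ^ l * P)) := by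
  have e₁ : t * (u ^ (l + 1) * t ^ l) = (t * u) ^ (l + 1) := by
    rw [(htu.symm.pow_pow (l + 1) l).eq, ← mul_assoc, ← pow_succ', htu.mul_pow]
  have e₂ : x * (u ^ l * (v * t ^ l)) = q⁻¹ ^ l • ((t * u) ^ l * P) := by
    rw [mul_pow_of_skewCommute hvt, mul_smul_comm, mul_smul_comm, ← mul_assoc x,
      mul_pow_of_skewCommute hxu, smul_mul_assoc, mul_assoc (u ^ l), ← mul_assoc x,
      mul_pow_of_skewCommute hxt, smul_mul_assoc, mul_smul_comm, smul_smul, smul_smul,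
      htu.mul_pow, (htu.pow_pow l l).eq, ← hxv]
    simp only [mul_assoc]
    congr 1
    rw [← mul_assoc, ← mul_pow, mul_inv_cancel₀ hq, one_pow, one_mul]
  rw [hD.leibniz, hD.map_pow_eq_zero ht, mul_zero, add_zero, hD.leibniz,
    hD.map_pow_succ h hσ hu, hx, map_pow, map_pow, hσ, hσt, _root_.smul_pow, _root_.smul_pow]
  simp only [mul_smul_comm, smul_mul_assoc, smul_smul, mul_assoc, add_mul, smul_add, e₁, e₂]
  congr 2
  · simp only [inv_pow]
    field_simp
    ring
  · ring

end IsSkewDerivation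

end SkewCommutation

theorem mul_qDeriv {q : K} (hq : q ^ 2 ≠ 1) (p : K[X]) :
    C (q ^ 2 - 1) * X * qDeriv K q p = p.comp (C (q ^ 2) * X) - p := by
  have h1 : C (q ^ 2 - 1) ≠ (0 : K[X]) := C_ne_zero.2 (sub_ne_zero.2 hq)
  rw [qDeriv, if_neg hq]
  refine EuclideanDomain.mul_div_cancel' (mul_ne_zero h1 X_ne_zero) ?_
  have hX : (X : K[X]) ∣ p.comp (C (q ^ 2) * X) - p := by
    rw [X_dvd_iff, coeff_zero_eq_eval_zero]
    simp
  refine (IsUnit.mul_left_dvd ?_).2 hX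
  exact isUnit_C.2 (isUnit_iff_ne_zero.2 (sub_ne_zero.2 hq))

theorem cPoly_mul_pow {q : K} (hq : q ^ 2 ≠ 1) (p : K[X]) (l : ℕ) :
    C (q ^ 2 - 1) * (C (q ^ (2 * l + 1)) * (cPoly K q p * X ^ (l + 1)) +
        C (∑ i ∈ Finset.range (l + 1), (q ^ 2) ^ i) * (X ^ l * p)) =
      C (q ^ 2) * p.comp (C (q ^ 2) * X) * (X ^ l : K[X]).comp (C (q ^ 2) * X) - p * X ^ l := by
  have hg : C (q ^ 2 - 1) * C (∑ i ∈ Finset.range (l + 1), (q ^ 2) ^ i) =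
      C ((q ^ 2) ^ (l + 1)) - (1 : K[X]) := by
    rw [← C_mul, mul_geom_sum, C_sub, C_1]
  calc _ = C (q ^ (2 * l + 1)) * C q * X ^ l * (C (q ^ 2 - 1) * X * qDeriv K q p) +
        (C (q ^ 2 - 1) * C (∑ i ∈ Finset.range (l + 1), (q ^ 2) ^ i)) * (X ^ l * p) := by
          rw [cPoly]; ring
    _ = _ := by
      rw [mul_qDeriv K hq, hg]
      simp only [X_pow_comp, C_pow, mul_pow]
      ring

section Generators

variable (q : K) (p : K[X])

theorem mkAlgHom_ι (i : Fin 4) :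
    RingQuot.mkAlgHom K (GWARel K q p) (FreeAlgebra.ι K i) = gwaGen K q p i := rfl

theorem zp_mul_zm : zp K q p * zm K q p = zm K q p * zp K q p := by
  simpa [mkAlgHom_ι, zp, zm] using RingQuot.mkAlgHom_rel K (GWARel.zz (q := q) (p := p))

theorem xp_mul_zp : xp K q p * zp K q p = q⁻¹ • (zp K q p * xp K q p) := by
  simpa [mkAlgHom_ι, zp, xp] using RingQuot.mkAlgHom_rel K (GWARel.xpzp (q := q) (p := p))

theorem xp_mul_zm : xp K q p * zm K q p = q⁻¹ • (zm K q p * xp K q p) := by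
  simpa [mkAlgHom_ι, zm, xp] using RingQuot.mkAlgHom_rel K (GWARel.xpzm (q := q) (p := p))

theorem xm_mul_zp : xm K q p * zp K q p = q • (zp K q p * xm K q p) := by
  simpa [mkAlgHom_ι, zp, xm] using RingQuot.mkAlgHom_rel K (GWARel.xmzp (q := q) (p := p))

theorem xm_mul_zm : xm K q p * zm K q p = q • (zm K q p * xm K q p) := by
  simpa [mkAlgHom_ι, zm, xm] using RingQuot.mkAlgHom_rel K (GWARel.xmzm (q := q) (p := p))

theorem xp_mul_xm : xp K q p * xm K q p = aeval (zm K q p * zp K q p) p := by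
  rw [← zp_mul_zm]
  simpa [mkAlgHom_ι, zm, xm, zp, xp, ← Polynomial.aeval_algHom_apply] using
    RingQuot.mkAlgHom_rel K (GWARel.xpxm (q := q) (p := p))

theorem gwaGen_mem_component (i : Fin 4) : gwaGen K q p i ∈ component K q p (gwaWt i) :=
  Submodule.subset_span ⟨[i], by simp [wordDeg], by simp [wordVal]⟩

theorem wordVal_mem_component (w : List (Fin 4)) :
    wordVal K q p w ∈ component K q p (wordDeg w) :=
  Submodule.subset_span ⟨w, rfl, rfl⟩

end Generators

/-- The right module map `Ω → A(p;q)` with prescribed values on the basis `ω₋, ω₀, ω₊`. -/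
def omegaRightHomOfBasis (q : K) (p : K[X]) (σm σ0 : GWA K q p ≃ₐ[K] GWA K q p)
    (a b c : GWA K q p) : OmegaRightHom K q p σm σ0 where
  toFun ω := a * σm.symm (ω 0) + b * σ0.symm (ω 1) + c * σm.symm (ω 2)
  map_add' ω η := by
    simp only [Pi.add_apply, map_add, mul_add]
    abel
  map_rmul' ω a := by
    simp [rAct, add_mul, mul_assoc]

section Image

variable {K} {q : K} {p : K[X]} {σm σ0 : GWA K q p ≃ₐ[K] GWA K q p}
  {D0 Dm Dp : GWA K q p →ₗ[K] GWA K q p}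

theorem divMap_mem_imDiv (a b c : GWA K q p) :
    q ^ (-2 : ℤ) • Dm a + D0 b + q ^ 2 • Dp c ∈ imDiv K q p σm σ0 D0 Dm Dp :=
  Submodule.subset_span ⟨omegaRightHomOfBasis K q p σm σ0 a b c, by
    simp [divMap, omegaRightHomOfBasis]⟩

theorem D0_mem_imDiv (a : GWA K q p) : D0 a ∈ imDiv K q p σm σ0 D0 Dm Dp := by
  simpa using divMap_mem_imDiv (σm := σm) (σ0 := σ0) (D0 := D0) (Dm := Dm) (Dp := Dp) 0 a 0

theorem Dm_mem_imDiv (hq : q ≠ 0) (a : GWA K q p) : Dm a ∈ imDiv K q p σm σ0 D0 Dm Dp := by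
  refine (Submodule.smul_mem_iff _ (zpow_ne_zero (-2) hq)).1 ?_
  simpa using divMap_mem_imDiv (σm := σm) (σ0 := σ0) (D0 := D0) (Dm := Dm) (Dp := Dp) a 0 0

theorem Dp_mem_imDiv (hq : q ≠ 0) (a : GWA K q p) : Dp a ∈ imDiv K q p σm σ0 D0 Dm Dp := by
  refine (Submodule.smul_mem_iff _ (pow_ne_zero 2 hq)).1 ?_
  simpa using divMap_mem_imDiv (σm := σm) (σ0 := σ0) (D0 := D0) (Dm := Dm) (Dp := Dp) 0 0 a

theorem D0_wordVal (hq : q ≠ 0) {α0 : K}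
    (hσ0 : ∀ (n : ℤ) (a : GWA K q p), a ∈ component K q p n → σ0 a = q ^ (2 * n) • a)
    (hD0 : IsSkewDerivation σ0 D0)
    (hgen : ∀ i, (q ^ 2 - 1) • D0 (gwaGen K q p i) =
      (α0 * (q ^ (2 * gwaWt i) - 1)) • gwaGen K q p i) (w : List (Fin 4)) :
    (q ^ 2 - 1) • D0 (wordVal K q p w) = (α0 * (q ^ (2 * wordDeg w) - 1)) • wordVal K q p w := by
  induction w with
  | nil => simp [wordVal, wordDeg, hD0.map_one]
  | cons i w ih =>
    have hv : wordVal K q p (i :: w) = gwaGen K q p i * wordVal K q p w := by simp [wordVal]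
    have hd : wordDeg (i :: w) = gwaWt i + wordDeg w := by simp [wordDeg]
    rw [hv, hd, hD0.leibniz, smul_add, ← smul_mul_assoc, hgen, ← mul_smul_comm, ih,
      hσ0 _ _ (wordVal_mem_component K q p w), smul_mul_assoc, mul_smul_comm, mul_smul_comm,
      smul_smul, ← add_smul, mul_add, zpow_add₀ hq]
    congr 1
    ring

end Image

/-- Identification of the kernel of the integral `Λ` associated to the
divergence: homogeneous elements of nonzero degree, the elements `x^{k+1}z^l` and
`y^{k+1}z^l`, and the combinations `q²p(q²z)f(q²z) − p(z)f(z)` all lie in `Im(div)`. -/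
theorem integral_kernel [CharZero K]
    (q : K) (hq : q ≠ 0) (p : K[X])
    (α0 αm αp : K)
    (σm : GWA K q p ≃ₐ[K] GWA K q p)
    (hσm : ∀ (n : ℤ) (a : GWA K q p), a ∈ component K q p n → σm a = q ^ n • a)
    (σ0 : GWA K q p ≃ₐ[K] GWA K q p)
    (hσ0 : ∀ (n : ℤ) (a : GWA K q p), a ∈ component K q p n → σ0 a = q ^ (2 * n) • a)
    (D0 Dm Dp : GWA K q p →ₗ[K] GWA K q p)
    (hD0leib : ∀ a b, D0 (a * b) = D0 a * σ0 b + a * D0 b)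
    (hD0xp : D0 (xp K q p) = α0 • xp K q p)
    (hD0xm : D0 (xm K q p) = -(q ^ (-2 : ℤ) * α0) • xm K q p)
    (hD0zp : D0 (zp K q p) = α0 • zp K q p)
    (hD0zm : D0 (zm K q p) = -(q ^ (-2 : ℤ) * α0) • zm K q p)
    (hDmleib : ∀ a b, Dm (a * b) = Dm a * σm b + a * Dm b)
    (hDmxp : Dm (xp K q p) = 0)
    (hDmzp : Dm (zp K q p) = 0)
    (hDmxm : Dm (xm K q p) = αm • (aeval (zp K q p * zm K q p) (cPoly K q p) * zp K q p))
    (hDmzm : Dm (zm K q p) = αm • xp K q p)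
    (hDpleib : ∀ a b, Dp (a * b) = Dp a * σm b + a * Dp b)
    (hDpxm : Dp (xm K q p) = 0)
    (hDpzm : Dp (zm K q p) = 0)
    (hDpxp : Dp (xp K q p) = αp • (aeval (zp K q p * zm K q p) (cPoly K q p) * zm K q p))
    (hDpzp : Dp (zp K q p) = αp • xm K q p)
    (hsep : QSeparable K q p)
    (hqru : ∀ n : ℕ, q ^ n = 1 → n = 0)
    (hα0 : α0 ≠ 0) (hαm : αm ≠ 0) (hαp : αp ≠ 0) :
    (∀ n : ℤ, n ≠ 0 → component K q p n ≤ imDiv K q p σm σ0 D0 Dm Dp) ∧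
    (∀ k l : ℕ,
      (xm K q p * zp K q p) ^ (k + 1) * (zm K q p * zp K q p) ^ l ∈ imDiv K q p σm σ0 D0 Dm Dp) ∧
    (∀ k l : ℕ,
      (zm K q p * xp K q p) ^ (k + 1) * (zm K q p * zp K q p) ^ l ∈ imDiv K q p σm σ0 D0 Dm Dp) ∧
    (∀ f : K[X],
      aeval (zm K q p * zp K q p)
        (C (q ^ 2) * p.comp (C (q ^ 2) * X) * f.comp (C (q ^ 2) * X) - p * f) ∈ imDiv K q p σm σ0 D0 Dm Dp) ∧
    (∀ n : ℤ, n ≠ 0 → ∀ a ∈ component K q p n, (imDiv K q p σm σ0 D0 Dm Dp).mkQ a = 0) ∧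
    (∀ k l : ℕ,
      (imDiv K q p σm σ0 D0 Dm Dp).mkQ
        ((xm K q p * zp K q p) ^ (k + 1) * (zm K q p * zp K q p) ^ l) = 0) ∧
    (∀ k l : ℕ,
      (imDiv K q p σm σ0 D0 Dm Dp).mkQ
        ((zm K q p * xp K q p) ^ (k + 1) * (zm K q p * zp K q p) ^ l) = 0) ∧
    (∀ f : K[X],
      (imDiv K q p σm σ0 D0 Dm Dp).mkQ
          (aeval (zm K q p * zp K q p)
            (C (q ^ 2) * p.comp (C (q ^ 2) * X) * f.comp (C (q ^ 2) * X)))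
        = (imDiv K q p σm σ0 D0 Dm Dp).mkQ (aeval (zm K q p * zp K q p) (p * f))) := by
  have hq2 : q ^ 2 ≠ 1 := fun h => two_ne_zero (hqru 2 h)
  have hq2' : q ^ 2 - 1 ≠ 0 := sub_ne_zero.2 hq2
  have hD0 : IsSkewDerivation σ0 D0 := ⟨hD0leib⟩
  have hDm : IsSkewDerivation σm Dm := ⟨hDmleib⟩
  have hDp : IsSkewDerivation σm Dp := ⟨hDpleib⟩
  have hqz : ∀ n : ℤ, q ^ (2 * n) = 1 → n = 0 := by
    intro n hn
    rcases Int.natAbs_eq n with h | h <;> rw [h] at hn ⊢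
    · have := hqru (2 * n.natAbs) (by exact_mod_cast hn)
      omega
    · rw [mul_neg, zpow_neg, inv_eq_one] at hn
      have := hqru (2 * n.natAbs) (by exact_mod_cast hn)
      omega
  have hgeom : ∀ n : ℕ, ∑ i ∈ Finset.range (n + 1), (q ^ 2) ^ i ≠ 0 := by
    intro n h
    have := mul_geom_sum (q ^ 2) (n + 1)
    rw [h, mul_zero, eq_comm, sub_eq_zero, ← pow_mul] at this
    have := hqru _ this
    omega
  have hgeom' : ∀ n : ℕ, ∑ i ∈ Finset.range (n + 1), (q⁻¹ ^ 2) ^ i ≠ 0 := by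
    intro n h
    have := mul_geom_sum (q⁻¹ ^ 2) (n + 1)
    rw [h, mul_zero, eq_comm, sub_eq_zero, ← pow_mul, inv_pow, inv_eq_one] at this
    have := hqru _ this
    omega
  have hσzp : σm (zp K q p) = q • zp K q p := by
    simpa [gwaWt, zp] using hσm _ _ (gwaGen_mem_component K q p 2)
  have hσzm : σm (zm K q p) = q⁻¹ • zm K q p := by
    simpa [gwaWt, zm] using hσm _ _ (gwaGen_mem_component K q p 3)
  have hcomm : Commute (zm K q p) (zp K q p) := (zp_mul_zm K q p).symm
  have hgen : ∀ i, (q ^ 2 - 1) • D0 (gwaGen K q p i) =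
      (α0 * (q ^ (2 * gwaWt i) - 1)) • gwaGen K q p i := by
    have hc₁ : (q ^ 2 - 1) * α0 = α0 * (q ^ (2 * (1 : ℤ)) - 1) := by
      rw [show (2 * 1 : ℤ) = (2 : ℕ) from rfl, zpow_natCast]
      ring
    have hc₂ : (q ^ 2 - 1) * -(q ^ (-2 : ℤ) * α0) = α0 * (q ^ (2 * (-1 : ℤ)) - 1) := by
      rw [show (2 * (-1) : ℤ) = -(2 : ℕ) from rfl, show (-2 : ℤ) = -(2 : ℕ) from rfl, zpow_neg,
        zpow_natCast]
      field_simp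
      ring
    intro i
    fin_cases i
    · change (q ^ 2 - 1) • D0 (xp K q p) = (α0 * (q ^ (2 * (1 : ℤ)) - 1)) • xp K q p
      rw [hD0xp, smul_smul, hc₁]
    · change (q ^ 2 - 1) • D0 (xm K q p) = (α0 * (q ^ (2 * (-1 : ℤ)) - 1)) • xm K q p
      rw [hD0xm, smul_smul, hc₂]
    · change (q ^ 2 - 1) • D0 (zp K q p) = (α0 * (q ^ (2 * (1 : ℤ)) - 1)) • zp K q p
      rw [hD0zp, smul_smul, hc₁]
    · change (q ^ 2 - 1) • D0 (zm K q p) = (α0 * (q ^ (2 * (-1 : ℤ)) - 1)) • zm K q p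
      rw [hD0zm, smul_smul, hc₂]
  set S := imDiv K q p σm σ0 D0 Dm Dp with hS
  have H₁ : ∀ n : ℤ, n ≠ 0 → component K q p n ≤ S := by
    intro n hn
    refine Submodule.span_le.2 ?_
    rintro _ ⟨w, rfl, rfl⟩
    have hne : α0 * (q ^ (2 * wordDeg w) - 1) ≠ 0 :=
      mul_ne_zero hα0 (sub_ne_zero.2 fun h => hn (hqz _ h))
    refine (S.smul_mem_iff hne).1 ?_
    rw [← D0_wordVal hq hσ0 hD0 hgen]
    exact S.smul_mem _ (D0_mem_imDiv _)
  have H₂ : ∀ k l : ℕ,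
      (xm K q p * zp K q p) ^ (k + 1) * (zm K q p * zp K q p) ^ l ∈ S :=
    hDp.mul_pow_mul_pow_mem (Dp_mem_imDiv hq) hq hαp hgeom (xm_mul_zp K q p) hcomm hσzp hσzm
      hDpzp hDpxm hDpzm
  have H₃ : ∀ k l : ℕ,
      (zm K q p * xp K q p) ^ (k + 1) * (zm K q p * zp K q p) ^ l ∈ S := by
    intro k l
    have h := hDm.mul_pow_mul_pow_mem (S := S) (Dm_mem_imDiv hq) (inv_ne_zero hq) hαm hgeom'
      (xp_mul_zm K q p) hcomm.symm hσzm (by rw [inv_inv, hσzp]) hDmzm hDmxp hDmzp k l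
    rw [xp_mul_zm, _root_.smul_pow, smul_mul_assoc, zp_mul_zm] at h
    exact (S.smul_mem_iff (pow_ne_zero _ (inv_ne_zero hq))).1 h
  have hmon : ∀ l : ℕ, aeval (zm K q p * zp K q p)
      (C (q ^ 2) * p.comp (C (q ^ 2) * X) * (X ^ l : K[X]).comp (C (q ^ 2) * X) - p * X ^ l)
        ∈ S := by
    intro l
    have h := hDp.map_mul_pow_mul_pow hq (xm_mul_zp K q p) (xm_mul_zm K q p) (xp_mul_zp K q p)
      (xp_mul_zm K q p) (xp_mul_xm K q p) hcomm hσzp hσzm hDpxp hDpzp hDpzm l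
    rw [zp_mul_zm] at h
    have hmem : Dp (xp K q p * zp K q p ^ (l + 1) * zm K q p ^ l) ∈ S := Dp_mem_imDiv hq _
    rw [h, S.smul_mem_iff
      (mul_ne_zero hαp (pow_ne_zero _ (pow_ne_zero _ (inv_ne_zero hq))))] at hmem
    rw [← cPoly_mul_pow K hq2]
    simpa only [map_mul, map_add, aeval_X_pow, aeval_C, ← Algebra.smul_def]
      using S.smul_mem (q ^ 2 - 1) hmem
  have H₄ : ∀ f : K[X], aeval (zm K q p * zp K q p)
      (C (q ^ 2) * p.comp (C (q ^ 2) * X) * f.comp (C (q ^ 2) * X) - p * f) ∈ S := by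
    intro f
    induction f using Polynomial.induction_on' with
    | add f g hf hg =>
      convert S.add_mem hf hg using 1
      rw [← map_add, add_comp]
      congr 1
      ring
    | monomial n a =>
      convert S.smul_mem a (hmon n) using 1
      rw [← map_smul, ← C_mul_X_pow_eq_monomial, mul_comp, C_comp, smul_eq_C_mul]
      congr 1
      ring
  refine ⟨H₁, H₂, H₃, H₄, fun n hn a ha => ?_, fun k l => ?_, fun k l => ?_, fun f => ?_⟩
  · exact (Submodule.Quotient.mk_eq_zero S).2 (H₁ n hn ha)
  · exact (Submodule.Quotient.mk_eq_zero S).2 (H₂ k l)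
  · exact (Submodule.Quotient.mk_eq_zero S).2 (H₃ k l)
  · refine (Submodule.Quotient.eq S).2 ?_
    rw [← map_sub]
    exact H₄ f

end GWAPaper
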